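/- arXiv:2211.02155 — 2 statements merged into one kernel-verified Lean document; each statement's English description precedes it below -/
import Mathlib

section
/- For every n ≥ 1, the monoid CI_n is defined by the presentation ⟨B | Q⟩ on 2 generators; that is, CI_n is isomorphic as a monoid to the quotient of the free monoid on B by the smallest monoid congruence containing Q, via an isomorphism sending the class of the letter g to the permutation g and the class of the letter e to the partial identity e_1 on Ω_n ∖ {1}. -/
/-!
Common setup.  `Ω_n = {1, …, n}` is modelled by `Fin n`, where `a : Fin n`
represents the element `a + 1` of `Ω_n`.  Partial maps on `Ω_n` are modelled as
functions `Fin n → Option (Fin n)`, composed left-to-right (as in the paper),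
which makes them a monoid (the monoid `PT_n` of all partial transformations).
-/

/-- Partial maps on `Ω_n`, composed left-to-right. -/
abbrev PMap (n : ℕ) := Fin n → Option (Fin n)

instance PMap.instMonoid (n : ℕ) : Monoid (PMap n) where
  one := fun a => some a
  mul f g := fun a => (f a).bind g
  one_mul f := rfl
  mul_one f := funext fun a => by
    show (f a).bind (fun b => some b) = f a
    cases f a <;> rfl
  mul_assoc f g h := funext fun a => by
    show ((f a).bind g).bind h = (f a).bind (fun b => (g b).bind h)
    cases f a <;> rfl

/-- The cyclic permutation `g : i ↦ i + 1` (for `1 ≤ i ≤ n-1`), `n ↦ 1`, of `Ω_n`,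
as a (total) partial map. -/
def gmap (n : ℕ) : PMap n := fun a => some (finRotate n a)

/-- `emap n i` is the partial identity on `Ω_n ∖ {i}` (the map `e_i` of the paper);
recall that `a : Fin n` represents the element `a + 1` of `Ω_n = {1, …, n}`. -/
def emap (n i : ℕ) : PMap n := fun a => if (a : ℕ) + 1 = i then none else some a

/-- The cyclic inverse monoid `CI_n`, as the set of all restrictions of elements of
`C_n = {1, g, g², …}` (including the empty map). -/
def CIn (n : ℕ) : Set (PMap n) :=
  {f | ∃ k : ℕ, ∀ a : Fin n, f a ≠ none → f a = (gmap n ^ k) a}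

/-- A partial map is order-preserving if it preserves `≤` on its domain. -/
def OrdPres {n : ℕ} (f : PMap n) : Prop :=
  ∀ a b c d : Fin n, a ≤ b → f a = some c → f b = some d → c ≤ d

/-- `OCI_n`: the order-preserving elements of `CI_n`. -/
def OCIn (n : ℕ) : Set (PMap n) := {f | f ∈ CIn n ∧ OrdPres f}

/-- `x = g e_1`, the partial map with domain `{1, …, n-1}` sending `i ↦ i + 1`. -/
def xmap (n : ℕ) : PMap n := gmap n * emap n 1

/-- `y = x⁻¹`, the partial map with domain `{2, …, n}` sending `i ↦ i - 1`. -/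
def ymap (n : ℕ) : PMap n := fun a =>
  if 1 ≤ (a : ℕ) then some ⟨(a : ℕ) - 1, Nat.lt_of_le_of_lt (Nat.sub_le _ _) a.isLt⟩ else none

/-! The two-letter alphabet `B = {g, e}`, modelled as `Bool`:
`false` is the letter `g` and `true` is the letter `e`. -/

/-- The free monoid on the alphabet `B = {g, e}`. -/
abbrev Bw := FreeMonoid Bool

/-- The letter `g`. -/
def Bg : Bw := FreeMonoid.of false

/-- The letter `e`. -/
def Be : Bw := FreeMonoid.of true

/-- The set `Q` of relations of the paper:
`(Q_1) gⁿ = 1`; `(Q_2) e² = e`;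
`(Q_3) e g^{n-j+i} e g^{n-i+j} = g^{n-j+i} e g^{n-i+j} e` for `1 ≤ i < j ≤ n`;
`(Q_4) g (e g^{n-1})ⁿ = (e g^{n-1})ⁿ`. -/
inductive Qrel (n : ℕ) : Bw → Bw → Prop
  | q1 : Qrel n (Bg ^ n) 1
  | q2 : Qrel n (Be * Be) Be
  | q3 (i j : ℕ) : 1 ≤ i → i < j → j ≤ n →
      Qrel n (Be * Bg ^ (n - j + i) * Be * Bg ^ (n - i + j))
             (Bg ^ (n - j + i) * Be * Bg ^ (n - i + j) * Be)
  | q4 : Qrel n (Bg * (Be * Bg ^ (n - 1)) ^ n) ((Be * Bg ^ (n - 1)) ^ n)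


section Abstract
variable {M : Type*} [Monoid M] (G : Mˣ) (e : M)

def EE (i : ℤ) : M := ((G ^ i : Mˣ) : M) * e * ((G ^ (-i) : Mˣ) : M)

def PP (l : List ℤ) : M := (l.map (EE G e)).prod

theorem zmul (i j : ℤ) : ((G ^ i : Mˣ) : M) * ((G ^ j : Mˣ) : M) = ((G ^ (i + j) : Mˣ) : M) := by
  rw [zpow_add, Units.val_mul]

theorem zmul' (i j : ℤ) (x : M) :
    ((G ^ i : Mˣ) : M) * (((G ^ j : Mˣ) : M) * x) = ((G ^ (i + j) : Mˣ) : M) * x := by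
  rw [zpow_add, Units.val_mul, mul_assoc]

theorem EE_shift (k i : ℤ) :
    ((G ^ k : Mˣ) : M) * EE G e i = EE G e (k + i) * ((G ^ k : Mˣ) : M) := by
  unfold EE
  simp only [mul_assoc, zmul, zmul']
  congr 4
  ring

theorem PP_nil : PP G e [] = 1 := by simp [PP]

theorem PP_cons (i : ℤ) (l : List ℤ) : PP G e (i :: l) = EE G e i * PP G e l := by simp [PP]

theorem PP_append (l l' : List ℤ) : PP G e (l ++ l') = PP G e l * PP G e l' := by simp [PP]

theorem PP_shift (k : ℤ) (l : List ℤ) :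
    ((G ^ k : Mˣ) : M) * PP G e l = PP G e (l.map (fun i => k + i)) * ((G ^ k : Mˣ) : M) := by
  induction l with
  | nil => simp [PP_nil]
  | cons i l ih =>
    rw [List.map_cons, PP_cons, PP_cons, ← mul_assoc, EE_shift, mul_assoc, ih, mul_assoc]

theorem eG_pow (m : ℕ) : (e * ((G ^ (-1 : ℤ) : Mˣ) : M)) ^ m =
    PP G e ((List.range m).map (fun i : ℕ => -(i : ℤ))) * ((G ^ (-(m : ℤ)) : Mˣ) : M) := by
  induction m with
  | zero => simp [PP_nil]
  | succ m ih =>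
    rw [pow_succ, ih, List.range_succ, List.map_append, PP_append, List.map_singleton, PP_cons,
      PP_nil]
    unfold EE
    simp only [mul_assoc, zmul, zmul', mul_one, one_mul]
    congr 5
    push_cast
    ring

variable (n : ℕ)

def KK (l : List ℤ) (a : ℤ) : Prop := ∃ i ∈ l, (n : ℤ) ∣ a + i

variable (hG : G ^ n = 1) (he : e * e = e)
  (hc : ∀ d : ℕ, 1 ≤ d → d < n → e * EE G e (-(d : ℤ)) = EE G e (-(d : ℤ)) * e)

section
include hG
theorem zpow_congr {i j : ℤ} (h : (n : ℤ) ∣ i - j) : G ^ i = G ^ j := by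
  obtain ⟨c, hc⟩ := h
  have : i = j + n * c := by linarith
  rw [this, zpow_add, zpow_mul, zpow_natCast, hG, one_zpow, mul_one]

theorem EE_congr {i j : ℤ} (h : (n : ℤ) ∣ i - j) : EE G e i = EE G e j := by
  unfold EE
  rw [zpow_neg, zpow_neg, zpow_congr G n hG h]
end

section
include he
theorem EE_idem (i : ℤ) : EE G e i * EE G e i = EE G e i := by
  unfold EE
  simp only [mul_assoc, zmul']
  simp only [neg_add_cancel, zpow_zero, Units.val_one, one_mul]
  rw [← mul_assoc e e, he]
end

section
include hG hc
theorem e_comm (hn : 1 ≤ n) (d : ℤ) : e * EE G e d = EE G e d * e := by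
  have hn' : (0 : ℤ) < n := by exact_mod_cast hn
  have h1 := Int.emod_nonneg (-d) hn'.ne'
  have h2 := Int.emod_lt_of_pos (-d) hn'
  obtain ⟨m, hm⟩ := Int.eq_ofNat_of_zero_le h1
  have : EE G e d = EE G e (-(m : ℤ)) := by
    apply EE_congr G e n hG
    rw [← hm]
    have := Int.emod_add_mul_ediv (-d) n
    exact ⟨-(-d / n), by linarith⟩
  rw [this]
  rcases Nat.eq_zero_or_pos m with rfl | h
  · simp [EE]
  · exact hc m h (by omega)

theorem EE_comm (hn : 1 ≤ n) (i j : ℤ) : EE G e i * EE G e j = EE G e j * EE G e i := by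
  have h := e_comm G e n hG hc hn (j - i)
  have h0 : e = EE G e 0 := by simp [EE]
  have h2 : EE G e 0 * EE G e (j - i) = EE G e (j - i) * EE G e 0 := by rw [← h0]; exact h
  have h3 := congrArg (fun x => ((G ^ i : Mˣ) : M) * x) h2
  rw [← mul_assoc, EE_shift, mul_assoc, EE_shift, ← mul_assoc, ← mul_assoc, EE_shift,
    mul_assoc (EE G e (i + (j - i))), EE_shift, ← mul_assoc] at h3
  have h4 := (Units.mul_left_inj _).1 h3
  simpa using h4

include he
theorem absorb (hn : 1 ≤ n) (l : List ℤ) (a : ℤ) (h : KK n l (-a)) :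
    EE G e a * PP G e l = PP G e l := by
  induction l with
  | nil => simp [KK] at h
  | cons i l ih =>
    obtain ⟨j, hj, hd⟩ := h
    rw [PP_cons]
    rcases List.mem_cons.1 hj with rfl | hj
    · rw [EE_congr G e n hG (i := a) (j := j), ← mul_assoc, EE_idem G e he]
      have := (dvd_neg (a := (n : ℤ))).2 hd
      rwa [show -(-a + j) = a - j by ring] at this
    · rw [← mul_assoc, EE_comm G e n hG hc hn, mul_assoc, ih ⟨j, hj, hd⟩]

theorem absorbP (hn : 1 ≤ n) (l l' : List ℤ) (h : ∀ a, KK n l a → KK n l' a) :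
    PP G e l * PP G e l' = PP G e l' := by
  have : ∀ i ∈ l, KK n l' (-i) := fun i hi => h _ ⟨i, hi, by simp⟩
  clear h
  induction l with
  | nil => simp [PP_nil]
  | cons i l ih =>
    rw [PP_cons, mul_assoc, ih fun j hj => this j (List.mem_cons_of_mem _ hj),
      absorb G e n hG he hc hn _ _ (this i List.mem_cons_self)]

theorem PP_eq (hn : 1 ≤ n) (l l' : List ℤ) (h : ∀ a, KK n l a ↔ KK n l' a) :
    PP G e l = PP G e l' := by
  have hcomm : PP G e l * PP G e l' = PP G e l' * PP G e l := by
    have : ∀ x ∈ l.map (EE G e), Commute x (PP G e l') := by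
      intro x hx
      obtain ⟨i, -, rfl⟩ := List.mem_map.1 hx
      apply Commute.list_prod_right
      intro y hy
      obtain ⟨j, -, rfl⟩ := List.mem_map.1 hy
      exact EE_comm G e n hG hc hn i j
    exact Commute.list_prod_left _ _ this
  rw [← absorbP G e n hG he hc hn l l' fun a => (h a).1, hcomm,
    absorbP G e n hG he hc hn l' l fun a => (h a).2]

theorem PP_zero (hn : 1 ≤ n)
    (h4 : (G : M) * (e * ((G ^ (-1 : ℤ) : Mˣ) : M)) ^ n = (e * ((G ^ (-1 : ℤ) : Mˣ) : M)) ^ n)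
    (l : List ℤ) (h : ∀ a, KK n l a) (k : ℕ) : PP G e l * (G : M) ^ k = PP G e l := by
  have hz : ((G ^ (-(n : ℤ)) : Mˣ) : M) = 1 := by simp [hG]
  rw [eG_pow, hz, mul_one] at h4
  set Z := PP G e ((List.range n).map (fun i : ℕ => -(i : ℤ)))
  have hZ : Z * PP G e l = PP G e l := absorbP G e n hG he hc hn _ _ fun a _ => h a
  have h1 : (G : M) * PP G e l = PP G e l := by
    rw [← hZ, ← mul_assoc, h4]
  have h2 := PP_shift G e 1 l
  rw [zpow_one, h1] at h2
  have h3 : PP G e (l.map (fun i => 1 + i)) = PP G e l := by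
    apply PP_eq G e n hG he hc hn
    intro a
    refine ⟨fun _ => h a, fun _ => ?_⟩
    obtain ⟨i, hi, hd⟩ := h (a + 1)
    exact ⟨1 + i, List.mem_map.2 ⟨i, hi, rfl⟩, by rwa [← add_assoc]⟩
  rw [h3] at h2
  induction k with
  | zero => simp
  | succ k ih => rw [pow_succ, ← mul_assoc, ih, ← h2]
end
end Abstract

section Concrete
variable (n : ℕ) [NeZero n]

theorem npos : (0 : ℤ) < n := by exact_mod_cast Nat.pos_of_neZero n

def rotf (k : ℤ) (a : Fin n) : Fin n := ⟨(((a : ℕ) + k : ℤ) % n).toNat, by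
  have h1 := Int.emod_nonneg ((a : ℕ) + k : ℤ) (npos n).ne'
  have h2 := Int.emod_lt_of_pos ((a : ℕ) + k : ℤ) (npos n)
  omega⟩

theorem rotf_val (k : ℤ) (a : Fin n) : (((rotf n k a : Fin n) : ℕ) : ℤ) = ((a : ℕ) + k : ℤ) % n := by
  have h1 := Int.emod_nonneg ((a : ℕ) + k : ℤ) (npos n).ne'
  simp only [rotf]
  omega

theorem fin_ext_int {a b : Fin n} (h : ((a : ℕ) : ℤ) = ((b : ℕ) : ℤ)) : a = b :=
  Fin.ext (by exact_mod_cast h)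

def rot : Multiplicative ℤ →* PMap n where
  toFun k := fun a => some (rotf n k.toAdd a)
  map_one' := by
    funext a
    show some _ = some a
    congr 1
    apply fin_ext_int
    rw [rotf_val, toAdd_one, add_zero]
    exact Int.emod_eq_of_lt (by omega) (by have := a.isLt; omega)
  map_mul' k l := by
    funext a
    show some _ = some _
    congr 1
    apply fin_ext_int
    rw [rotf_val, rotf_val, rotf_val, toAdd_mul, Int.emod_add_emod, add_assoc]

def gU : (PMap n)ˣ := Units.map (rot n) (toUnits (Multiplicative.ofAdd (1 : ℤ)))

theorem gU_zpow (k : ℤ) (a : Fin n) : ((gU n ^ k : (PMap n)ˣ) : PMap n) a = some (rotf n k a) := by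
  have : ((gU n ^ k : (PMap n)ˣ) : PMap n) = rot n (Multiplicative.ofAdd k) := by
    unfold gU
    rw [← map_zpow, ← map_zpow, ← ofAdd_zsmul]
    simp
  rw [this]; rfl

theorem gU_val : ((gU n : (PMap n)ˣ) : PMap n) = gmap n := by
  funext a
  have := gU_zpow n 1 a
  rw [zpow_one] at this
  rw [this]
  show some _ = some _
  congr 1
  apply fin_ext_int
  rw [rotf_val]
  obtain ⟨m, rfl⟩ := Nat.exists_eq_succ_of_ne_zero (NeZero.ne n)
  rw [finRotate_succ_apply, Fin.val_add]
  push_cast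
  simp

theorem gU_pow (k : ℕ) (a : Fin n) : (gmap n ^ k) a = some (rotf n k a) := by
  rw [← gU_val, ← gU_zpow]; simp

theorem gU_n : gU n ^ n = 1 := by
  ext a : 2
  rw [Units.val_pow_eq_pow_val, gU_val, gU_pow]
  show some _ = some a
  congr 1
  apply fin_ext_int
  rw [rotf_val, Int.add_emod_right]
  exact Int.emod_eq_of_lt (by omega) (by have := a.isLt; omega)

theorem pmul (f g : PMap n) (a : Fin n) : (f * g) a = (f a).bind g := rfl

open Classical in
theorem EE_apply (i : ℤ) (a : Fin n) :
    EE (gU n) (emap n 1) i a = if (n : ℤ) ∣ (a : ℕ) + i then none else some a := by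
  unfold EE
  rw [pmul, pmul, gU_zpow]
  simp only [Option.bind_some, emap]
  have hv := rotf_val n i a
  have : ((rotf n i a : Fin n) : ℕ) + 1 = 1 ↔ (n : ℤ) ∣ (a : ℕ) + i := by
    rw [Int.dvd_iff_emod_eq_zero, ← hv]; omega
  simp only [this]
  split_ifs
  · rfl
  · rw [Option.bind_some, gU_zpow]
    congr 1
    apply fin_ext_int
    rw [rotf_val, rotf_val, Int.emod_add_emod, add_neg_cancel_right]
    exact Int.emod_eq_of_lt (by omega) (by have := a.isLt; omega)

open Classical in
theorem PP_apply (l : List ℤ) (a : Fin n) :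
    PP (gU n) (emap n 1) l a = if KK n l (a : ℕ) then none else some a := by
  induction l with
  | nil => simp [PP_nil, KK]; rfl
  | cons i l ih =>
    rw [PP_cons, pmul, EE_apply]
    have : KK n (i :: l) (a : ℕ) ↔ (n : ℤ) ∣ (a : ℕ) + i ∨ KK n l (a : ℕ) := by
      simp [KK]
    rw [this]
    by_cases h : (n : ℤ) ∣ (a : ℕ) + i
    · simp [h]
    · simp [h, ih]

theorem KK_fin {l : List ℤ} (a : ℤ) : KK n l a ↔ KK n l ((rotf n a 0 : Fin n) : ℕ) := by
  unfold KK
  rw [rotf_val]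
  simp only [Int.dvd_iff_emod_eq_zero, Int.emod_add_emod, Fin.val_zero, Nat.cast_zero, zero_add]

theorem emap_idem : emap n 1 * emap n 1 = emap n 1 := by
  funext a
  rw [pmul]
  unfold emap
  split_ifs with h
  · rfl
  · rw [Option.bind_some, if_neg h]

theorem EEmap_comm (i j : ℤ) : EE (gU n) (emap n 1) i * EE (gU n) (emap n 1) j =
    EE (gU n) (emap n 1) j * EE (gU n) (emap n 1) i := by
  classical
  funext a
  rw [pmul, pmul, EE_apply, EE_apply]
  split_ifs <;> simp [EE_apply, *]

theorem gpred {M : Type*} [Monoid M] (G : Mˣ) (h : G ^ n = 1) :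
    (G : M) ^ (n - 1) = ((G ^ (-1 : ℤ) : Mˣ) : M) := by
  rw [← Units.val_pow_eq_pow_val, ← zpow_natCast]
  rw [zpow_congr G n h (j := -1)]
  have := Nat.pos_of_neZero n
  exact ⟨1, by omega⟩

/-- Relations `Q₃` in terms of conjugates. -/
theorem q3_iff {M : Type*} [Monoid M] (G : Mˣ) (e : M) (h : G ^ n = 1) (i j : ℕ) (hij : i < j)
    (hj : j ≤ n) :
    (e * (G : M) ^ (n - j + i) * e * (G : M) ^ (n - i + j) =
      (G : M) ^ (n - j + i) * e * (G : M) ^ (n - i + j) * e) ↔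
    e * EE G e (-((j - i : ℕ) : ℤ)) = EE G e (-((j - i : ℕ) : ℤ)) * e := by
  unfold EE
  simp only [← Units.val_pow_eq_pow_val, ← zpow_natCast]
  rw [zpow_congr G n h (i := ((n - j + i : ℕ) : ℤ)) (j := -((j - i : ℕ) : ℤ)) ⟨1, by omega⟩,
    zpow_congr G n h (i := ((n - i + j : ℕ) : ℤ)) (j := -(-((j - i : ℕ) : ℤ))) ⟨1, by omega⟩]
  simp only [mul_assoc]

def lift0 : Bw →* PMap n := FreeMonoid.lift (fun b => if b then emap n 1 else gmap n)

theorem lift0_g : lift0 n Bg = gU n := by simp [lift0, Bg, gU_val]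

theorem lift0_e : lift0 n Be = emap n 1 := by simp [lift0, Be]

theorem KK_all (a : ℤ) : KK n ((List.range n).map (fun i : ℕ => -(i : ℤ))) a := by
  have h1 := Int.emod_nonneg a (npos n).ne'
  have h2 := Int.emod_lt_of_pos a (npos n)
  refine ⟨-((a % n).toNat : ℤ), List.mem_map.2 ⟨(a % n).toNat, ?_, rfl⟩, ?_⟩
  · rw [List.mem_range]; omega
  · rw [Int.toNat_of_nonneg h1]
    exact ⟨a / n, by have := Int.emod_add_mul_ediv a n; linarith⟩

theorem lift0_rel : conGen (Qrel n) ≤ Con.ker (lift0 n) := by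
  rw [Con.conGen_le]
  intro x y h
  rw [Con.ker_rel]
  cases h with
  | q1 => rw [map_pow, map_one, lift0_g, ← Units.val_pow_eq_pow_val, gU_n]; rfl
  | q2 => rw [map_mul, lift0_e, emap_idem]
  | q3 i j hi hij hj =>
    simp only [map_mul, map_pow, lift0_g, lift0_e]
    rw [q3_iff n _ _ (gU_n n) i j hij hj]
    have := EEmap_comm n 0 (-((j - i : ℕ) : ℤ))
    rwa [show EE (gU n) (emap n 1) 0 = emap n 1 by simp [EE]] at this
  | q4 =>
    simp only [map_mul, map_pow, lift0_g, lift0_e]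
    rw [gpred n _ (gU_n n), eG_pow]
    have hz : ((gU n ^ (-(n : ℤ)) : (PMap n)ˣ) : PMap n) = 1 := by simp [gU_n]
    rw [hz, mul_one]
    have : PP (gU n) (emap n 1) ((List.range n).map (fun i : ℕ => -(i : ℤ))) = fun _ => none := by
      funext a
      rw [PP_apply, if_pos (KK_all n _)]
    rw [this]
    funext a
    rw [pmul]
    cases (gU n : PMap n) a <;> rfl

def phi : (conGen (Qrel n)).Quotient →* PMap n := Con.lift _ (lift0 n) (lift0_rel n)

abbrev QM := (conGen (Qrel n)).Quotient

def qe : QM n := (conGen (Qrel n)).mk' Be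

theorem qrel {x y : Bw} (h : Qrel n x y) : (conGen (Qrel n)).mk' x = (conGen (Qrel n)).mk' y :=
  (Con.eq _).2 (ConGen.Rel.of _ _ h)

def qg : (QM n)ˣ := Units.ofPowEqOne ((conGen (Qrel n)).mk' Bg) n
  (by rw [← map_pow, qrel n Qrel.q1, map_one]) (NeZero.ne n)

theorem qg_val : (qg n : QM n) = (conGen (Qrel n)).mk' Bg := rfl

theorem qg_pow : qg n ^ n = 1 := Units.pow_ofPowEqOne _ _

theorem qe_idem : qe n * qe n = qe n := by
  have := qrel n Qrel.q2
  rwa [map_mul] at this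

theorem q_comm (d : ℕ) (hd : 1 ≤ d) (hdn : d < n) :
    qe n * EE (qg n) (qe n) (-(d : ℤ)) = EE (qg n) (qe n) (-(d : ℤ)) * qe n := by
  have h := qrel n (Qrel.q3 1 (1 + d) le_rfl (by omega) (by omega))
  simp only [map_mul, map_pow] at h
  have h2 := (q3_iff n (qg n) (qe n) (qg_pow n) 1 (1 + d) (by omega) (by omega)).1 h
  simpa using h2

theorem q_four : (qg n : QM n) * (qe n * ((qg n ^ (-1 : ℤ) : (QM n)ˣ) : QM n)) ^ n =
    (qe n * ((qg n ^ (-1 : ℤ) : (QM n)ˣ) : QM n)) ^ n := by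
  have h := qrel n Qrel.q4
  simp only [map_mul, map_pow] at h
  rw [← gpred n _ (qg_pow n)]
  exact h

theorem phi_g : phi n (qg n : QM n) = gU n := by
  rw [qg_val, ← lift0_g]; rfl

theorem phi_e : phi n (qe n) = emap n 1 := by
  rw [← lift0_e]; rfl

theorem phi_zpow (k : ℤ) : phi n ((qg n ^ k : (QM n)ˣ) : QM n) = ((gU n ^ k : (PMap n)ˣ) : PMap n) := by
  have : Units.map (phi n) (qg n) = gU n := Units.ext (phi_g n)
  rw [← this, ← map_zpow]; rfl

theorem phi_PP (l : List ℤ) : phi n (PP (qg n) (qe n) l) = PP (gU n) (emap n 1) l := by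
  induction l with
  | nil => simp [PP_nil]
  | cons i l ih =>
    rw [PP_cons, PP_cons, map_mul, ih]
    unfold EE
    rw [map_mul, map_mul, phi_zpow, phi_zpow, phi_e]

open Classical in
theorem phi_nf (l : List ℤ) (k : ℕ) (a : Fin n) :
    phi n (PP (qg n) (qe n) l * (qg n : QM n) ^ k) a =
      if KK n l (a : ℕ) then none else some (rotf n k a) := by
  rw [map_mul, map_pow, phi_PP, phi_g, gU_val, pmul, PP_apply]
  split_ifs
  · rfl
  · rw [Option.bind_some, gU_pow]

theorem nf (x : QM n) : ∃ l : List ℤ, ∃ k : ℕ, x = PP (qg n) (qe n) l * (qg n : QM n) ^ k := by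
  obtain ⟨w, rfl⟩ := Con.mk'_surjective x
  have key : ∀ (w : List Bool), ∃ l : List ℤ, ∃ k : ℕ, (conGen (Qrel n)).mk' (FreeMonoid.ofList w) =
      PP (qg n) (qe n) l * (qg n : QM n) ^ k := by
    intro w
    induction w using List.reverseRecOn with
    | nil => exact ⟨[], 0, by rw [PP_nil, pow_zero, mul_one, FreeMonoid.ofList_nil, map_one]⟩
    | append_singleton w b ih =>
      obtain ⟨l, k, h⟩ := ih
      rw [FreeMonoid.ofList_append, map_mul, h]
      cases b with
      | false => exact ⟨l, k + 1, by rw [pow_succ, ← mul_assoc]; rfl⟩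
      | true =>
        refine ⟨l ++ [(k : ℤ)], k, ?_⟩
        rw [PP_append, PP_cons, PP_nil, mul_one, mul_assoc, mul_assoc]
        congr 1
        have h := EE_shift (qg n) (qe n) k 0
        rw [add_zero, zpow_natCast, Units.val_pow_eq_pow_val,
          show EE (qg n) (qe n) 0 = qe n by simp [EE]] at h
        exact h
  exact key (FreeMonoid.toList w)

theorem phi_inj : Function.Injective (phi n) := by
  classical
  intro x y hxy
  have hn : 1 ≤ n := Nat.pos_of_neZero n
  obtain ⟨l, k, rfl⟩ := nf n x
  obtain ⟨l', k', rfl⟩ := nf n y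
  have H : ∀ a : Fin n, (if KK n l (a : ℕ) then none else some (rotf n k a)) =
      if KK n l' (a : ℕ) then none else some (rotf n k' a) := fun a => by
    rw [← phi_nf, ← phi_nf, hxy]
  have hK : ∀ a, KK n l a ↔ KK n l' a := by
    intro a
    rw [KK_fin n a, KK_fin n (l := l') a]
    have := H (rotf n a 0)
    by_cases h1 : KK n l ((rotf n a 0 : Fin n) : ℕ) <;>
      by_cases h2 : KK n l' ((rotf n a 0 : Fin n) : ℕ) <;> simp_all
  have hP := PP_eq (qg n) (qe n) n (qg_pow n) (qe_idem n) (q_comm n) hn l l' hK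
  by_cases hall : ∀ a, KK n l a
  · rw [PP_zero (qg n) (qe n) n (qg_pow n) (qe_idem n) (q_comm n) hn (q_four n) l hall,
      PP_zero (qg n) (qe n) n (qg_pow n) (qe_idem n) (q_comm n) hn (q_four n) l'
        (fun a => (hK a).1 (hall a)), hP]
  · push Not at hall
    obtain ⟨a, ha⟩ := hall
    have ha' := ha
    rw [hK] at ha'
    rw [KK_fin] at ha ha'
    have h := H (rotf n a 0)
    rw [if_neg ha, if_neg ha', Option.some_inj] at h
    have h2 := congrArg (fun b : Fin n => ((b : ℕ) : ℤ)) h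
    simp only [rotf_val n] at h2
    have h3 : (n : ℤ) ∣ (k : ℤ) - k' := by
      have := Int.ModEq.add_left_cancel' _ (show Int.ModEq n _ _ from h2)
      exact this.symm.dvd
    have h4 := zpow_congr (qg n) n (qg_pow n) h3
    rw [zpow_natCast, zpow_natCast] at h4
    rw [hP, ← Units.val_pow_eq_pow_val, h4, Units.val_pow_eq_pow_val]

theorem phi_range : Set.range (phi n) = CIn n := by
  classical
  ext f
  constructor
  · rintro ⟨x, rfl⟩
    obtain ⟨l, k, rfl⟩ := nf n x
    refine ⟨k, fun a ha => ?_⟩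
    rw [phi_nf] at ha ⊢
    rw [gU_pow]
    split_ifs at ha ⊢
    · exact absurd rfl ha
    · rfl
  · rintro ⟨k, hk⟩
    let l : List ℤ := ((Finset.univ.filter (fun a : Fin n => f a = none)).toList).map
      (fun a : Fin n => -((a : ℕ) : ℤ))
    refine ⟨PP (qg n) (qe n) l * (qg n : QM n) ^ k, ?_⟩
    funext a
    rw [phi_nf]
    have : KK n l (a : ℕ) ↔ f a = none := by
      constructor
      · rintro ⟨i, hi, hd⟩
        obtain ⟨b, hb, rfl⟩ := List.mem_map.1 hi
        have hb' : f b = none := by simpa using hb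
        have : a = b := by
          apply fin_ext_int
          have h0 := Int.eq_zero_of_abs_lt_dvd hd (by
            have := a.isLt; have := b.isLt; rw [abs_lt]; constructor <;> omega)
          omega
        rw [this]; exact hb'
      · intro h
        exact ⟨_, List.mem_map.2 ⟨a, by simpa using h, rfl⟩, by simp⟩
    by_cases h : f a = none
    · rw [if_pos (this.2 h), h]
    · rw [if_neg (fun h' => h (this.1 h')), hk a h, gU_pow]

end Concrete

/-- For `n ≥ 1`, the monoid `CI_n` is defined by the presentation
`⟨B | Q⟩` on `2` generators: the quotient of the free monoid on `B = {g, e}` by the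
smallest congruence containing `Q` is isomorphic to `CI_n`, via an isomorphism sending
the class of the letter `g` to the permutation `g` and the class of the letter `e`
to the partial identity `e_1` on `Ω_n ∖ {1}`. -/
theorem CIn.presentation₂ (n : ℕ) (hn : 1 ≤ n) :
    ∃ φ : (conGen (Qrel n)).Quotient →* PMap n,
      Function.Injective φ ∧ Set.range φ = CIn n ∧
      φ ((conGen (Qrel n)).mk' Bg) = gmap n ∧
      φ ((conGen (Qrel n)).mk' Be) = emap n 1 := by
  haveI : NeZero n := ⟨by omega⟩
  exact ⟨phi n, phi_inj n, phi_range n, (phi_g n).trans (gU_val n), phi_e n⟩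
end

section
/- For every n ≥ 1, the monoid OCI_n is defined by the presentation ⟨C | U⟩; that is, OCI_n is isomorphic as a monoid to the quotient of the free monoid on C by the smallest monoid congruence containing U. -/
/-! The alphabet `C = {x, y, e_1, …, e_n}` (with `n + 2` letters), modelled as
`Bool ⊕ Fin n`: `.inl false` is the letter `x`, `.inl true` is the letter `y`,
and `.inr i` is the letter `e_{i+1}`. -/

/-- The free monoid on the alphabet `C = {x, y, e_1, …, e_n}`. -/
abbrev Cw (n : ℕ) := FreeMonoid (Bool ⊕ Fin n)

/-- The letter `x`. -/
def Cx (n : ℕ) : Cw n := FreeMonoid.of (Sum.inl false)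

/-- The letter `y`. -/
def Cy (n : ℕ) : Cw n := FreeMonoid.of (Sum.inl true)

/-- The letter `e_{i+1}` (so `Ce ⟨0,_⟩ = e_1`, …, `Ce ⟨n-1,_⟩ = e_n`). -/
def Ce {n : ℕ} (i : Fin n) : Cw n := FreeMonoid.of (Sum.inr i)

/-- The word `e_1 e_2 ⋯ e_n`. -/
def CeProd (n : ℕ) : Cw n := ((List.finRange n).map Ce).prod

/-- The word `e_2 ⋯ e_n`. -/
def CeProdTail (n : ℕ) : Cw n := (((List.finRange n).drop 1).map Ce).prod

/-- The set `U` of relations of the paper (in `0`-based indexing of the letters `e`):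
`(U_1) e_i² = e_i`; `(U_2) xy = e_n` and `yx = e_1`; `(U_3) x e_1 = x` and `e_1 y = y`;
`(U_4) e_i e_j = e_j e_i` for `i < j`; `(U_5) x e_{i+1} = e_i x` for `1 ≤ i ≤ n-1`;
`(U_6) x e_2 ⋯ e_n = e_1 e_2 ⋯ e_n`. -/
inductive Urel (n : ℕ) : Cw n → Cw n → Prop
  | u1 (i : Fin n) : Urel n (Ce i * Ce i) (Ce i)
  | u2a (j : Fin n) : (j : ℕ) = n - 1 → Urel n (Cx n * Cy n) (Ce j)
  | u2b (i : Fin n) : (i : ℕ) = 0 → Urel n (Cy n * Cx n) (Ce i)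
  | u3a (i : Fin n) : (i : ℕ) = 0 → Urel n (Cx n * Ce i) (Cx n)
  | u3b (i : Fin n) : (i : ℕ) = 0 → Urel n (Ce i * Cy n) (Cy n)
  | u4 (i j : Fin n) : i < j → Urel n (Ce i * Ce j) (Ce j * Ce i)
  | u5 (i j : Fin n) : (i : ℕ) + 1 = (j : ℕ) → Urel n (Cx n * Ce j) (Ce i * Cx n)
  | u6 : Urel n (Cx n * CeProdTail n) (CeProd n)

/-! ### Abstract normal forms -/

/-- The relations `U`, in an arbitrary monoid. -/
structure URels {Q : Type*} [Monoid Q] (m : ℕ) (x y : Q) (e : Fin (m + 1) → Q) : Prop where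
  u1 : ∀ i, e i * e i = e i
  u2a : x * y = e (Fin.last m)
  u2b : y * x = e 0
  u3a : x * e 0 = x
  u3b : e 0 * y = y
  u4 : ∀ i j, e i * e j = e j * e i
  u5 : ∀ i : Fin m, x * e i.succ = e i.castSucc * x
  u6 : x * (((List.finRange (m + 1)).drop 1).map e).prod = ((List.finRange (m + 1)).map e).prod

/-- Integer powers: `x^k` for `k ≥ 0`, `y^(-k)` for `k ≤ 0`. -/
def zpw {Q : Type*} [Monoid Q] (x y : Q) (k : ℤ) : Q := x ^ k.toNat * y ^ (-k).toNat

/-- Product of the idempotents in a list. -/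
def eP {Q : Type*} [Monoid Q] {m : ℕ} (e : Fin (m + 1) → Q) (L : List (Fin (m + 1))) : Q :=
  (L.map e).prod

theorem eP_append {Q : Type*} [Monoid Q] {m : ℕ} (e : Fin (m + 1) → Q)
    (L M : List (Fin (m + 1))) : eP e (L ++ M) = eP e L * eP e M := by
  simp [eP]

theorem eP_cons {Q : Type*} [Monoid Q] {m : ℕ} (e : Fin (m + 1) → Q)
    (i : Fin (m + 1)) (M : List (Fin (m + 1))) : eP e (i :: M) = e i * eP e M := by
  simp [eP]

theorem eP_nil {Q : Type*} [Monoid Q] {m : ℕ} (e : Fin (m + 1) → Q) : eP e [] = 1 := by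
  simp [eP]

namespace URels

variable {Q : Type*} [Monoid Q] {m : ℕ} {x y : Q} {e : Fin (m + 1) → Q}

theorem eP_comm1 (h : URels m x y e) (i : Fin (m + 1)) (L : List (Fin (m + 1))) :
    e i * eP e L = eP e L * e i := by
  induction L with
  | nil => simp [eP_nil]
  | cons j L ih => rw [eP_cons, ← mul_assoc, h.u4 i j, mul_assoc, ih, mul_assoc]

theorem eP_comm (h : URels m x y e) (M L : List (Fin (m + 1))) :
    eP e M * eP e L = eP e L * eP e M := by
  induction M with
  | nil => simp [eP_nil]
  | cons j M ih => rw [eP_cons, mul_assoc, ih, ← mul_assoc, h.eP_comm1, mul_assoc]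

theorem eP_absorb1 (h : URels m x y e) {i : Fin (m + 1)} {L : List (Fin (m + 1))} (hi : i ∈ L) :
    e i * eP e L = eP e L := by
  induction L with
  | nil => simp at hi
  | cons j L ih =>
    rw [eP_cons, ← mul_assoc]
    rcases List.mem_cons.1 hi with rfl | hi
    · rw [h.u1]
    · rw [h.u4, mul_assoc, ih hi]

theorem eP_absorb (h : URels m x y e) {M L : List (Fin (m + 1))} (hi : ∀ i ∈ M, i ∈ L) :
    eP e M * eP e L = eP e L := by
  induction M with
  | nil => simp [eP_nil]
  | cons j M ih =>
    rw [eP_cons, mul_assoc, ih (fun i hh => hi i (List.mem_cons_of_mem _ hh)),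
      h.eP_absorb1 (hi j (by simp))]

theorem eP_ext (h : URels m x y e) {M L : List (Fin (m + 1))} (hi : ∀ i, i ∈ M ↔ i ∈ L) :
    eP e M = eP e L := by
  rw [← h.eP_absorb (M := M) (L := L) (fun i hh => (hi i).1 hh), h.eP_comm,
    h.eP_absorb (fun i hh => (hi i).2 hh)]

theorem last_x (h : URels m x y e) : e (Fin.last m) * x = x := by
  rw [← h.u2a, mul_assoc, h.u2b, h.u3a]

theorem y_last (h : URels m x y e) : y * e (Fin.last m) = y := by
  rw [← h.u2a, ← mul_assoc, h.u2b, h.u3b]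

theorem y_e (h : URels m x y e) (i : Fin m) : y * e i.castSucc = e i.succ * y := by
  have h1 : y * (x * e i.succ) * y = y * (e i.castSucc * x) * y := by rw [h.u5]
  have h2 : y * (x * e i.succ) * y = e i.succ * y := by
    rw [← mul_assoc, h.u2b, h.u4, mul_assoc, h.u3b]
  have h3 : y * (e i.castSucc * x) * y = y * e i.castSucc := by
    rw [mul_assoc, mul_assoc, h.u2a, h.u4, ← mul_assoc, h.y_last]
  rw [← h3, ← h1, h2]

theorem xpow_e (h : URels m x y e) (k : ℕ) (i : Fin (m + 1)) :
    ∃ L, x ^ k * e i = eP e L * x ^ k := by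
  induction k generalizing i with
  | zero => exact ⟨[i], by simp [eP]⟩
  | succ k ih =>
    induction i using Fin.cases with
    | zero => exact ⟨[], by rw [eP_nil, pow_succ, mul_assoc, h.u3a, one_mul]⟩
    | succ i =>
      obtain ⟨L, hL⟩ := ih i.castSucc
      exact ⟨L, by rw [pow_succ, mul_assoc, h.u5, ← mul_assoc, hL, mul_assoc]⟩

theorem ypow_e (h : URels m x y e) (k : ℕ) (i : Fin (m + 1)) :
    ∃ L, y ^ k * e i = eP e L * y ^ k := by
  induction k generalizing i with
  | zero => exact ⟨[i], by simp [eP]⟩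
  | succ k ih =>
    induction i using Fin.lastCases with
    | last => exact ⟨[], by rw [eP_nil, pow_succ, mul_assoc, h.y_last, one_mul]⟩
    | cast i =>
      obtain ⟨L, hL⟩ := ih i.succ
      exact ⟨L, by rw [pow_succ, mul_assoc, h.y_e, ← mul_assoc, hL, mul_assoc]⟩

theorem e_xpow (h : URels m x y e) (k : ℕ) (i : Fin (m + 1)) (hi : m + 1 ≤ i + k) :
    e i * x ^ k = x ^ k := by
  induction k generalizing i with
  | zero => omega
  | succ k ih =>
    induction i using Fin.lastCases with
    | last => rw [pow_succ', ← mul_assoc, h.last_x]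
    | cast i =>
      rw [pow_succ', ← mul_assoc, ← h.u5, mul_assoc, ih]
      simp at hi ⊢; omega

theorem e_ypow (h : URels m x y e) (k : ℕ) (i : Fin (m + 1)) (hi : (i : ℕ) < k) :
    e i * y ^ k = y ^ k := by
  induction k generalizing i with
  | zero => omega
  | succ k ih =>
    induction i using Fin.cases with
    | zero => rw [pow_succ', ← mul_assoc, h.u3b]
    | succ i =>
      rw [pow_succ', ← mul_assoc, ← h.y_e, mul_assoc, ih]
      simp at hi ⊢; omega

theorem zpw_nat (k : ℕ) : zpw x y (k : ℤ) = x ^ k := by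
  simp [zpw]

theorem zpw_neg (k : ℕ) : zpw x y (-(k : ℤ)) = y ^ k := by
  simp [zpw]

theorem e_zpw (h : URels m x y e) (k : ℤ) (i : Fin (m + 1))
    (hi : ¬ (0 ≤ (i : ℤ) + k ∧ (i : ℤ) + k < m + 1)) : e i * zpw x y k = zpw x y k := by
  obtain ⟨k, rfl | rfl⟩ := k.eq_nat_or_neg
  · rw [zpw_nat]; exact h.e_xpow k i (by omega)
  · rw [zpw_neg]; exact h.e_ypow k i (by omega)

theorem zpw_e (h : URels m x y e) (k : ℤ) (i : Fin (m + 1)) :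
    ∃ L, zpw x y k * e i = eP e L * zpw x y k := by
  obtain ⟨k, rfl | rfl⟩ := k.eq_nat_or_neg
  · rw [zpw_nat]; exact h.xpow_e k i
  · rw [zpw_neg]; exact h.ypow_e k i

theorem zpw_x (h : URels m x y e) (k : ℤ) :
    ∃ L, zpw x y k * x = eP e L * zpw x y (k + 1) := by
  obtain ⟨k, rfl | rfl⟩ := k.eq_nat_or_neg
  · refine ⟨[], ?_⟩
    have := zpw_nat (x := x) (y := y) (k + 1)
    push_cast at this
    rw [zpw_nat, this, eP_nil, one_mul, pow_succ]
  · cases k with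
    | zero => exact ⟨[], by simp [zpw, eP_nil]⟩
    | succ k =>
      obtain ⟨L, hL⟩ := h.ypow_e k 0
      refine ⟨L, ?_⟩
      rw [zpw_neg, show (-((k + 1 : ℕ) : ℤ) + 1) = -(k : ℤ) by push_cast; ring, zpw_neg,
        ← hL, pow_succ, mul_assoc, h.u2b]

theorem zpw_y (h : URels m x y e) (k : ℤ) :
    ∃ L, zpw x y k * y = eP e L * zpw x y (k - 1) := by
  obtain ⟨k, rfl | rfl⟩ := k.eq_nat_or_neg
  · cases k with
    | zero => exact ⟨[], by simp [zpw, eP_nil]⟩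
    | succ k =>
      obtain ⟨L, hL⟩ := h.xpow_e k (Fin.last m)
      refine ⟨L, ?_⟩
      rw [zpw_nat, show (((k + 1 : ℕ) : ℤ) - 1) = (k : ℤ) by push_cast; ring, zpw_nat,
        ← hL, pow_succ, mul_assoc, h.u2a]
  · refine ⟨[], ?_⟩
    have := zpw_neg (x := x) (y := y) (k + 1)
    rw [zpw_neg, show (-(k : ℤ) - 1) = -((k + 1 : ℕ) : ℤ) by push_cast; ring, this, eP_nil,
      one_mul, pow_succ]

/-- Saturation of a normal form. -/
theorem saturate (h : URels m x y e) (L : List (Fin (m + 1))) (k : ℤ) :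
    ∃ M : List (Fin (m + 1)),
      (∀ i : Fin (m + 1), ¬ (0 ≤ (i : ℤ) + k ∧ (i : ℤ) + k < m + 1) → i ∈ M) ∧
      eP e L * zpw x y k = eP e M * zpw x y k := by
  have key : ∀ S : List (Fin (m + 1)),
      (∀ i ∈ S, ¬ (0 ≤ (i : ℤ) + k ∧ (i : ℤ) + k < m + 1)) →
      eP e S * zpw x y k = zpw x y k := by
    intro S hS
    induction S with
    | nil => simp [eP_nil]
    | cons j S ih =>
      rw [eP_cons, mul_assoc, ih (fun i hi => hS i (List.mem_cons_of_mem _ hi)),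
        h.e_zpw k j (hS j (by simp))]
  classical
  refine ⟨L ++ (List.finRange (m + 1)).filter
    (fun i : Fin (m + 1) => decide (¬ (0 ≤ (i : ℤ) + k ∧ (i : ℤ) + k < m + 1))), ?_, ?_⟩
  · intro i hi
    simp only [List.mem_append, List.mem_filter, List.mem_finRange, true_and, decide_eq_true_eq]
    exact Or.inr hi
  · rw [eP_append, mul_assoc, key (List.filter _ _)]
    intro i hi
    simpa only [List.mem_filter, List.mem_finRange, true_and, decide_eq_true_eq] using hi

theorem x_eP (h : URels m x y e) (L : List (Fin m)) :
    x * eP e (L.map Fin.succ) = eP e (L.map Fin.castSucc) * x := by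
  induction L with
  | nil => simp [eP_nil]
  | cons j L ih =>
    rw [List.map_cons, List.map_cons, eP_cons, eP_cons, ← mul_assoc, h.u5, mul_assoc, ih,
      mul_assoc]

theorem y_eP (h : URels m x y e) (L : List (Fin m)) :
    y * eP e (L.map Fin.castSucc) = eP e (L.map Fin.succ) * y := by
  induction L with
  | nil => simp [eP_nil]
  | cons j L ih =>
    rw [List.map_cons, List.map_cons, eP_cons, eP_cons, ← mul_assoc, h.y_e, mul_assoc, ih,
      mul_assoc]

theorem full_succ (_h : URels m x y e) :
    eP e (List.finRange (m + 1)) = e 0 * eP e ((List.finRange m).map Fin.succ) := by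
  rw [← eP_cons, ← List.finRange_succ]

theorem full_cast (h : URels m x y e) :
    eP e (List.finRange (m + 1)) =
      e (Fin.last m) * eP e ((List.finRange m).map Fin.castSucc) := by
  rw [← eP_cons]
  apply h.eP_ext
  intro i
  simp only [List.mem_finRange, true_iff]
  induction i using Fin.lastCases with
  | last => simp
  | cast i => exact List.mem_cons_of_mem _ (List.mem_map_of_mem (List.mem_finRange i))

theorem x_tail (h : URels m x y e) :
    x * eP e ((List.finRange m).map Fin.succ) = eP e (List.finRange (m + 1)) := by
  have := h.u6
  rw [List.finRange_succ, List.drop_one, List.tail_cons, ← List.finRange_succ] at this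
  exact this

theorem zero_x (h : URels m x y e) :
    eP e (List.finRange (m + 1)) * x = eP e (List.finRange (m + 1)) := by
  conv_lhs => rw [h.full_cast, h.eP_comm1, mul_assoc, h.last_x, ← h.x_eP, h.x_tail]

theorem x_zero (h : URels m x y e) :
    x * eP e (List.finRange (m + 1)) = eP e (List.finRange (m + 1)) := by
  conv_lhs => rw [h.full_succ, ← mul_assoc, h.u3a, h.x_tail]

theorem y_zero (h : URels m x y e) :
    y * eP e (List.finRange (m + 1)) = eP e (List.finRange (m + 1)) := by
  conv_lhs => rw [← h.x_zero, ← mul_assoc, h.u2b]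
  exact h.eP_absorb1 (List.mem_finRange 0)

theorem zero_y (h : URels m x y e) :
    eP e (List.finRange (m + 1)) * y = eP e (List.finRange (m + 1)) := by
  conv_lhs => rw [h.full_succ, h.eP_comm1, mul_assoc, h.u3b, ← h.y_eP]
  conv_rhs => rw [← h.y_zero, h.full_cast, ← mul_assoc, h.y_last]

theorem zero_zpw (h : URels m x y e) (k : ℤ) :
    eP e (List.finRange (m + 1)) * zpw x y k = eP e (List.finRange (m + 1)) := by
  have hx : ∀ k : ℕ, eP e (List.finRange (m + 1)) * x ^ k = eP e (List.finRange (m + 1)) := by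
    intro k
    induction k with
    | zero => simp
    | succ k ih => rw [pow_succ, ← mul_assoc, ih, h.zero_x]
  have hy : ∀ k : ℕ, eP e (List.finRange (m + 1)) * y ^ k = eP e (List.finRange (m + 1)) := by
    intro k
    induction k with
    | zero => simp
    | succ k ih => rw [pow_succ, ← mul_assoc, ih, h.zero_y]
  rw [zpw, ← mul_assoc, hx, hy]

end URels

/-! ### Partial maps -/

theorem PMap.mul_apply' {n : ℕ} (f g : PMap n) (a : Fin n) : (f * g) a = (f a).bind g := rfl

theorem PMap.one_apply' {n : ℕ} (a : Fin n) : (1 : PMap n) a = some a := rfl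

theorem gmap_apply' (m : ℕ) (a : Fin (m + 1)) :
    gmap (m + 1) a = some ⟨((a : ℕ) + 1) % (m + 1), Nat.mod_lt _ (Nat.succ_pos m)⟩ := by
  simp only [gmap, finRotate_apply]
  congr 1
  ext
  simp [Fin.val_add]

theorem gmap_pow (m k : ℕ) (a : Fin (m + 1)) :
    (gmap (m + 1) ^ k) a = some ⟨((a : ℕ) + k) % (m + 1), Nat.mod_lt _ (Nat.succ_pos m)⟩ := by
  induction k with
  | zero =>
    rw [pow_zero, PMap.one_apply']
    congr 1; ext; simp [Nat.mod_eq_of_lt a.isLt]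
  | succ k ih =>
    rw [pow_succ, PMap.mul_apply', ih, Option.bind_some, gmap_apply']
    congr 1; ext; simp [add_assoc]

/-- The map `f` is the shift by `k` with the domain cut down to the complement of `L`. -/
def IsSh {m : ℕ} (f : PMap (m + 1)) (L : List (Fin (m + 1))) (k : ℤ) : Prop :=
  ∀ a b, f a = some b ↔ (a ∉ L ∧ (b : ℤ) = a + k)

theorem xmap_some (m : ℕ) (a b : Fin (m + 1)) :
    xmap (m + 1) a = some b ↔ (b : ℤ) = a + 1 := by
  rw [xmap, PMap.mul_apply', gmap_apply', Option.bind_some, emap]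
  have := a.isLt
  have := b.isLt
  by_cases h : (a : ℕ) + 1 < m + 1
  · rw [if_neg (by simp [Nat.mod_eq_of_lt h])]
    simp only [Option.some.injEq, Fin.ext_iff, Nat.mod_eq_of_lt h]
    omega
  · have : (a : ℕ) + 1 = m + 1 := by omega
    rw [if_pos (by simp [this])]
    simp; omega

theorem ymap_some (m : ℕ) (a b : Fin (m + 1)) :
    ymap (m + 1) a = some b ↔ (b : ℤ) = a - 1 := by
  rw [ymap]
  split_ifs with h
  · simp only [Option.some.injEq, Fin.ext_iff]; omega
  · simp; omega

theorem emap_some (m : ℕ) (i a b : Fin (m + 1)) :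
    emap (m + 1) ((i : ℕ) + 1) a = some b ↔ a ≠ i ∧ a = b := by
  rw [emap]
  split_ifs with h
  · simp; intro h1; exact absurd (Fin.ext (by omega)) h1
  · simp; intro _ h1; apply h; simp [h1]

theorem eP_some {m : ℕ} (L : List (Fin (m + 1))) (a b : Fin (m + 1)) :
    eP (fun i : Fin (m + 1) => emap (m + 1) ((i : ℕ) + 1)) L a = some b ↔ a ∉ L ∧ a = b := by
  induction L with
  | nil => simp [eP_nil, PMap.one_apply']
  | cons j L ih =>
    rw [eP_cons, PMap.mul_apply', Option.bind_eq_some_iff]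
    constructor
    · rintro ⟨c, hc, hb⟩
      obtain ⟨h1, rfl⟩ := (emap_some m j a c).1 hc
      obtain ⟨h2, rfl⟩ := ih.1 hb
      simp [h1, h2]
    · rintro ⟨h1, rfl⟩
      simp only [List.mem_cons, not_or] at h1
      exact ⟨a, (emap_some m j a a).2 ⟨h1.1, rfl⟩, ih.2 ⟨h1.2, rfl⟩⟩

theorem xpow_some (m k : ℕ) (a b : Fin (m + 1)) :
    (xmap (m + 1) ^ k) a = some b ↔ (b : ℤ) = a + k := by
  induction k generalizing b with
  | zero => simp [PMap.one_apply', Fin.ext_iff]; omega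
  | succ k ih =>
    rw [pow_succ, PMap.mul_apply', Option.bind_eq_some_iff]
    constructor
    · rintro ⟨c, hc, hb⟩
      have h1 := (ih c).1 hc
      have h2 := (xmap_some m c b).1 hb
      push_cast; omega
    · intro h
      push_cast at h
      exact ⟨⟨a + k, by omega⟩, (ih _).2 (by simp), (xmap_some m _ b).2 (by push_cast; omega)⟩

theorem ypow_some (m k : ℕ) (a b : Fin (m + 1)) :
    (ymap (m + 1) ^ k) a = some b ↔ (b : ℤ) = a - k := by
  induction k generalizing b with
  | zero => simp [PMap.one_apply', Fin.ext_iff]; omega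
  | succ k ih =>
    rw [pow_succ, PMap.mul_apply', Option.bind_eq_some_iff]
    constructor
    · rintro ⟨c, hc, hb⟩
      have h1 := (ih c).1 hc
      have h2 := (ymap_some m c b).1 hb
      push_cast; omega
    · intro h
      push_cast at h
      exact ⟨⟨a - k, by omega⟩, (ih _).2 (by simp; omega),
        (ymap_some m _ b).2 (by simp; omega)⟩

theorem zpw_some (m : ℕ) (k : ℤ) (a b : Fin (m + 1)) :
    zpw (xmap (m + 1)) (ymap (m + 1)) k a = some b ↔ (b : ℤ) = a + k := by
  obtain ⟨k, rfl | rfl⟩ := k.eq_nat_or_neg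
  · rw [URels.zpw_nat, xpow_some]
  · rw [URels.zpw_neg, ypow_some, sub_eq_add_neg]

theorem isSh_nf (m : ℕ) (L : List (Fin (m + 1))) (k : ℤ) :
    IsSh (eP (fun i : Fin (m + 1) => emap (m + 1) ((i : ℕ) + 1)) L *
      zpw (xmap (m + 1)) (ymap (m + 1)) k) L k := by
  intro a b
  rw [PMap.mul_apply', Option.bind_eq_some_iff]
  constructor
  · rintro ⟨c, hc, hb⟩
    obtain ⟨h1, rfl⟩ := (eP_some L a c).1 hc
    exact ⟨h1, (zpw_some m k a b).1 hb⟩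
  · rintro ⟨h1, h2⟩
    exact ⟨a, (eP_some L a a).2 ⟨h1, rfl⟩, (zpw_some m k a b).2 h2⟩

theorem isSh_mem {m : ℕ} {f : PMap (m + 1)} {L : List (Fin (m + 1))} {k : ℤ} (h : IsSh f L k) :
    f ∈ OCIn (m + 1) := by
  refine ⟨⟨(k % ((m : ℤ) + 1)).toNat, ?_⟩, ?_⟩
  · intro a ha
    obtain ⟨b, hb⟩ := Option.ne_none_iff_exists'.1 ha
    rw [hb, gmap_pow]
    congr 1
    ext
    have h1 := ((h a b).1 hb).2
    have hm : (0 : ℤ) < (m : ℤ) + 1 := by omega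
    have h2 := Int.emod_nonneg k hm.ne'
    zify
    rw [Int.toNat_of_nonneg h2, Int.add_emod_emod, ← h1, Int.emod_eq_of_lt] <;> omega
  · intro a b c d hab hc hd
    have h1 := ((h a c).1 hc).2
    have h2 := ((h b d).1 hd).2
    rw [Fin.le_def] at *
    omega

theorem pmap_ext {n : ℕ} {f g : PMap n} (h : ∀ a b, f a = some b ↔ g a = some b) : f = g := by
  funext a
  exact Option.ext (h a)

theorem isSh_of_mem {m : ℕ} {f : PMap (m + 1)} (h : f ∈ OCIn (m + 1)) :
    ∃ L k, IsSh f L k := by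
  obtain ⟨⟨k, hk⟩, ho⟩ := h
  classical
  have hk' : ∀ a b, f a = some b → (b : ℕ) = ((a : ℕ) + k) % (m + 1) := by
    intro a b hab
    have := hk a (by simp [hab])
    rw [hab, gmap_pow] at this
    exact congrArg Fin.val (Option.some.inj this)
  have key : ∃ K : ℤ, ∀ a b, f a = some b → (b : ℤ) = a + K := by
    by_cases hd : ∃ a b, f a = some b
    · obtain ⟨a₀, b₀, h0⟩ := hd
      refine ⟨b₀ - a₀, fun a b hab => ?_⟩
      have e0 := hk' _ _ h0
      have e1 := hk' _ _ hab
      have d0 := Nat.div_add_mod ((a₀ : ℕ) + k) (m + 1)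
      have d1 := Nat.div_add_mod ((a : ℕ) + k) (m + 1)
      rw [← e0] at d0
      rw [← e1] at d1
      generalize ((a₀ : ℕ) + k) / (m + 1) = q0 at d0
      generalize ((a : ℕ) + k) / (m + 1) = q1 at d1
      have hq : q0 = q1 := by
        have ha := a.isLt
        have hb := b.isLt
        have ha0 := a₀.isLt
        have hb0 := b₀.isLt
        rcases le_total a₀ a with hle | hle
        · have := ho _ _ _ _ hle h0 hab
          rw [Fin.le_def] at *
          by_contra hne
          rcases Nat.lt_or_gt_of_ne hne with hlt | hlt
          · have := Nat.mul_le_mul_left (m + 1) hlt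
            rw [Nat.mul_succ] at this
            omega
          · have := Nat.mul_le_mul_left (m + 1) hlt
            rw [Nat.mul_succ] at this
            omega
        · have := ho _ _ _ _ hle hab h0
          rw [Fin.le_def] at *
          by_contra hne
          rcases Nat.lt_or_gt_of_ne hne with hlt | hlt
          · have := Nat.mul_le_mul_left (m + 1) hlt
            rw [Nat.mul_succ] at this
            omega
          · have := Nat.mul_le_mul_left (m + 1) hlt
            rw [Nat.mul_succ] at this
            omega
      subst hq
      omega
    · exact ⟨0, fun a b hab => absurd ⟨a, b, hab⟩ hd⟩
  obtain ⟨K, hK⟩ := key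
  refine ⟨(List.finRange (m + 1)).filter (fun a => decide (f a = none)), K, fun a b => ?_⟩
  simp only [List.mem_filter, List.mem_finRange, true_and, decide_eq_true_eq]
  constructor
  · intro hab
    exact ⟨by simp [hab], hK a b hab⟩
  · rintro ⟨h1, h2⟩
    obtain ⟨c, hc⟩ := Option.ne_none_iff_exists'.1 h1
    have := hK a c hc
    rw [hc, Option.some.injEq, Fin.ext_iff]
    omega

/-- The images of the letters. -/
def letMap (n : ℕ) : Bool ⊕ Fin n → PMap n
  | .inl false => xmap n
  | .inl true => ymap n
  | .inr i => emap n ((i : ℕ) + 1)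

theorem lift_rel (m : ℕ) (u v : Cw (m + 1)) (h : Urel (m + 1) u v) :
    FreeMonoid.lift (letMap (m + 1)) u = FreeMonoid.lift (letMap (m + 1)) v := by
  have hx : FreeMonoid.lift (letMap (m + 1)) (Cx (m + 1)) = xmap (m + 1) := by simp [Cx, letMap]
  have hy : FreeMonoid.lift (letMap (m + 1)) (Cy (m + 1)) = ymap (m + 1) := by simp [Cy, letMap]
  have he : ∀ i : Fin (m + 1), FreeMonoid.lift (letMap (m + 1)) (Ce i) =
      emap (m + 1) ((i : ℕ) + 1) := by intro i; simp [Ce, letMap]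
  have hP : ∀ L : List (Fin (m + 1)), FreeMonoid.lift (letMap (m + 1)) (L.map Ce).prod =
      eP (fun i : Fin (m + 1) => emap (m + 1) ((i : ℕ) + 1)) L := by
    intro L
    rw [map_list_prod, List.map_map, eP]
    congr 1
  apply pmap_ext
  intro a b
  have ha := a.isLt
  have hb := b.isLt
  cases h with
  | u6 =>
    rw [map_mul, hx, CeProdTail, CeProd, hP, hP, PMap.mul_apply', Option.bind_eq_some_iff, eP_some]
    simp only [List.mem_finRange, not_true, false_and, iff_false]
    rintro ⟨c, hc, hb⟩
    have h1 := (xmap_some m a c).1 hc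
    have h2 := ((eP_some _ c b).1 hb).1
    apply h2
    rw [List.finRange_succ, List.drop_one, List.tail_cons, List.mem_map]
    exact ⟨⟨a, by omega⟩, List.mem_finRange _, by ext; simp; omega⟩
  | u1 i =>
    simp only [map_mul, he, PMap.mul_apply', Option.bind_eq_some_iff, emap_some]
    constructor
    · rintro ⟨c, ⟨h1, rfl⟩, h2⟩; exact h2
    · intro h; exact ⟨a, ⟨h.1, rfl⟩, h⟩
  | u2a j hj =>
    simp only [map_mul, hx, hy, he, PMap.mul_apply', Option.bind_eq_some_iff, emap_some,
      xmap_some, ymap_some, Fin.ext_iff, ne_eq]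
    constructor
    · rintro ⟨c, h1, h2⟩
      have := c.isLt
      omega
    · rintro ⟨h1, h2⟩
      exact ⟨⟨a + 1, by omega⟩, by simp, by simp; omega⟩
  | u2b j hj =>
    simp only [map_mul, hx, hy, he, PMap.mul_apply', Option.bind_eq_some_iff, emap_some,
      xmap_some, ymap_some, Fin.ext_iff, ne_eq]
    constructor
    · rintro ⟨c, h1, h2⟩
      have := c.isLt
      omega
    · rintro ⟨h1, h2⟩
      exact ⟨⟨a - 1, by omega⟩, by simp; omega, by simp; omega⟩
  | u3a j hj =>
    simp only [map_mul, hx, hy, he, PMap.mul_apply', Option.bind_eq_some_iff, emap_some,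
      xmap_some, ymap_some, Fin.ext_iff, ne_eq]
    constructor
    · rintro ⟨c, h1, h2⟩
      omega
    · intro h1
      exact ⟨b, h1, by omega, rfl⟩
  | u3b j hj =>
    simp only [map_mul, hx, hy, he, PMap.mul_apply', Option.bind_eq_some_iff, emap_some,
      xmap_some, ymap_some, Fin.ext_iff, ne_eq]
    constructor
    · rintro ⟨c, h1, h2⟩
      omega
    · intro h1
      exact ⟨a, ⟨by omega, rfl⟩, h1⟩
  | u4 i j hij =>
    simp only [map_mul, he, PMap.mul_apply', Option.bind_eq_some_iff, emap_some]
    constructor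
    · rintro ⟨c, ⟨h1, rfl⟩, h2, rfl⟩; exact ⟨a, ⟨h2, rfl⟩, h1, rfl⟩
    · rintro ⟨c, ⟨h1, rfl⟩, h2, rfl⟩; exact ⟨a, ⟨h2, rfl⟩, h1, rfl⟩
  | u5 i j hij =>
    simp only [map_mul, hx, hy, he, PMap.mul_apply', Option.bind_eq_some_iff, emap_some,
      xmap_some, ymap_some, Fin.ext_iff, ne_eq]
    constructor
    · rintro ⟨c, h1, h2⟩
      exact ⟨a, ⟨by omega, rfl⟩, by omega⟩
    · rintro ⟨c, h1, h2⟩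
      exact ⟨b, by omega, by omega, rfl⟩

/-- The quotient satisfies the relations. -/
theorem quot_rels (m : ℕ) :
    URels m ((conGen (Urel (m + 1))).mk' (Cx (m + 1))) ((conGen (Urel (m + 1))).mk' (Cy (m + 1)))
      (fun i => (conGen (Urel (m + 1))).mk' (Ce i)) := by
  have key : ∀ u v, Urel (m + 1) u v →
      (conGen (Urel (m + 1))).mk' u = (conGen (Urel (m + 1))).mk' v := by
    intro u v h
    exact ((conGen (Urel (m + 1))).eq).2 (ConGen.Rel.of _ _ h)
  refine ⟨?_, ?_, ?_, ?_, ?_, ?_, ?_, ?_⟩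
  · intro i; simpa only [map_mul] using key _ _ (Urel.u1 i)
  · simpa only [map_mul] using key _ _ (Urel.u2a (Fin.last m) (by simp))
  · simpa only [map_mul] using key _ _ (Urel.u2b 0 (by simp))
  · simpa only [map_mul] using key _ _ (Urel.u3a 0 (by simp))
  · simpa only [map_mul] using key _ _ (Urel.u3b 0 (by simp))
  · intro i j
    rcases lt_trichotomy i j with h | rfl | h
    · simpa only [map_mul] using key _ _ (Urel.u4 i j h)
    · rfl
    · simpa only [map_mul] using (key _ _ (Urel.u4 j i h)).symm
  · intro i
    simpa only [map_mul] using key _ _ (Urel.u5 i.castSucc i.succ (by simp))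
  · have := key _ _ (Urel.u6 (n := m + 1))
    rw [map_mul, CeProdTail, CeProd, map_list_prod, map_list_prod, List.map_map,
      List.map_map] at this
    exact this

/-- Every element of the quotient has a normal form. -/
theorem quot_nf (m : ℕ) (w : Cw (m + 1)) : ∃ L k,
    (conGen (Urel (m + 1))).mk' w = eP (fun i => (conGen (Urel (m + 1))).mk' (Ce i)) L *
      zpw ((conGen (Urel (m + 1))).mk' (Cx (m + 1))) ((conGen (Urel (m + 1))).mk' (Cy (m + 1)))
        k := by
  have h := quot_rels m
  set π := (conGen (Urel (m + 1))).mk' with hπ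
  have step : ∀ (w : Cw (m + 1)) (c : Bool ⊕ Fin (m + 1)),
      (∃ L k, π w = eP (fun i => π (Ce i)) L * zpw (π (Cx (m + 1))) (π (Cy (m + 1))) k) →
      ∃ L k, π (w * FreeMonoid.of c) =
        eP (fun i => π (Ce i)) L * zpw (π (Cx (m + 1))) (π (Cy (m + 1))) k := by
    rintro w c ⟨L, k, hw⟩
    rcases c with (_ | _) | i
    · obtain ⟨M, hM⟩ := h.zpw_x k
      refine ⟨L ++ M, k + 1, ?_⟩
      rw [map_mul, hw, eP_append, mul_assoc, mul_assoc, ← hM]; rfl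
    · obtain ⟨M, hM⟩ := h.zpw_y k
      refine ⟨L ++ M, k - 1, ?_⟩
      rw [map_mul, hw, eP_append, mul_assoc, mul_assoc, ← hM]; rfl
    · obtain ⟨M, hM⟩ := h.zpw_e k i
      refine ⟨L ++ M, k, ?_⟩
      rw [map_mul, hw, eP_append, mul_assoc, mul_assoc, ← hM]; rfl
  have gen : ∀ l : List (Bool ⊕ Fin (m + 1)), ∃ L k,
      π (FreeMonoid.ofList l) =
        eP (fun i => π (Ce i)) L * zpw (π (Cx (m + 1))) (π (Cy (m + 1))) k := by
    intro l
    induction l using List.reverseRecOn with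
    | nil => exact ⟨[], 0, by simp [eP_nil, zpw]⟩
    | append_singleton l c ih =>
      have := step _ c ih
      rwa [← FreeMonoid.ofList_singleton, ← FreeMonoid.ofList_append] at this
  exact gen w.toList

/-- For `n ≥ 1`, the monoid `OCI_n` is defined by the presentation
`⟨C | U⟩`: the quotient of the free monoid on `C = {x, y, e_1, …, e_n}` by the smallest
congruence containing `U` is isomorphic to `OCI_n` (an injective monoid homomorphism
onto the set `OCI_n`). -/
theorem OCIn.presentation (n : ℕ) (hn : 1 ≤ n) :
    ∃ φ : (conGen (Urel n)).Quotient →* PMap n,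
      Function.Injective φ ∧ Set.range φ = OCIn n := by
  obtain ⟨m, rfl⟩ : ∃ m, n = m + 1 := ⟨n - 1, by omega⟩
  have hle : conGen (Urel (m + 1)) ≤ Con.ker (FreeMonoid.lift (letMap (m + 1))) :=
    Con.conGen_le.2 (fun u v h => lift_rel m u v h)
  have h := quot_rels m
  have hnf : ∀ q : (conGen (Urel (m + 1))).Quotient, ∃ L k,
      (∀ i : Fin (m + 1), ¬ (0 ≤ (i : ℤ) + k ∧ (i : ℤ) + k < m + 1) → i ∈ L) ∧
      q = eP (fun i => (conGen (Urel (m + 1))).mk' (Ce i)) L *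
        zpw ((conGen (Urel (m + 1))).mk' (Cx (m + 1))) ((conGen (Urel (m + 1))).mk' (Cy (m + 1)))
          k := by
    intro q
    obtain ⟨w, rfl⟩ := Con.mk'_surjective q
    obtain ⟨L, k, hw⟩ := quot_nf m w
    obtain ⟨M, hM, he⟩ := h.saturate L k
    exact ⟨M, k, hM, hw.trans he⟩
  let φ := Con.lift (conGen (Urel (m + 1))) (FreeMonoid.lift (letMap (m + 1))) hle
  have hmk : ∀ w, φ ((conGen (Urel (m + 1))).mk' w) = FreeMonoid.lift (letMap (m + 1)) w :=
    fun w => Con.lift_mk' hle w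
  have hsh : ∀ L k, IsSh (φ (eP (fun i => (conGen (Urel (m + 1))).mk' (Ce i)) L *
        zpw ((conGen (Urel (m + 1))).mk' (Cx (m + 1))) ((conGen (Urel (m + 1))).mk' (Cy (m + 1)))
          k)) L k := by
    intro L k
    have e1 := isSh_nf m L k
    convert e1 using 1
    rw [map_mul, eP, map_list_prod, List.map_map, eP, zpw, zpw, map_mul, map_pow, map_pow,
      hmk, hmk]
    congr 3
  refine ⟨φ, ?_, ?_⟩
  · intro p q hpq
    obtain ⟨L, k, hL, rfl⟩ := hnf p
    obtain ⟨M, l, hM, rfl⟩ := hnf q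
    have h1 := hsh L k
    have h2 := hsh M l
    rw [hpq] at h1
    have hdom : ∀ {L M : List (Fin (m + 1))} {k l : ℤ} {f : PMap (m + 1)},
        IsSh f L k → IsSh f M l →
        (∀ i : Fin (m + 1), ¬ (0 ≤ (i : ℤ) + k ∧ (i : ℤ) + k < m + 1) → i ∈ L) →
        ∀ i, i ∉ L → i ∉ M ∧ k = l := by
      intro L M k l f h1 h2 hL i hi
      have hr : 0 ≤ (i : ℤ) + k ∧ (i : ℤ) + k < m + 1 := by
        by_contra hc
        exact hi (hL i hc)
      have hf := (h1 i ⟨((i : ℤ) + k).toNat, by omega⟩).2 ⟨hi, by simp; omega⟩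
      have hg := (h2 _ _).1 hf
      refine ⟨hg.1, ?_⟩
      have := hg.2
      simp at this
      omega
    have d1 := hdom h1 h2 hL
    have d2 := hdom h2 h1 hM
    have hLM : ∀ i, i ∈ L ↔ i ∈ M := fun i =>
      ⟨fun hi => by by_contra hc; exact (d2 i hc).1 hi,
        fun hi => by by_contra hc; exact (d1 i hc).1 hi⟩
    rw [h.eP_ext hLM]
    by_cases hall : ∀ i, i ∈ M
    · rw [h.eP_ext (M := M) (L := List.finRange (m + 1)) (fun i => by simp [hall i]),
        h.zero_zpw, h.zero_zpw]
    · push Not at hall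
      obtain ⟨i, hi⟩ := hall
      rw [(d2 i hi).2]
  · ext f
    constructor
    · rintro ⟨q, rfl⟩
      obtain ⟨L, k, hL, rfl⟩ := hnf q
      exact isSh_mem (hsh L k)
    · intro hf
      obtain ⟨L, k, hLk⟩ := isSh_of_mem hf
      exact ⟨_, pmap_ext fun a b => ((hsh L k) a b).trans (hLk a b).symm⟩
end
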